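/- Let 0 < c₁ < c₂, set M := √c₂ − √c₁, and let r > 0 satisfy M·r ≥ log(2·√c₂/√c₁). Then √c₂ − √c₁·cosh(M·r) − c₁·r·sinh(M·r) < 0; consequently the derivative of J(c₃) := D(c₁, c₃; r) + D(c₂, c₃; r) at the left endpoint c₃ = c₁ is strictly negative. -/

import Mathlib

/-- The hyperbolic manifold distance
`D(c₁, c₃; r) = (−√c₁ + 2·√c₃·cosh((√c₃ − √c₁)·r)) / (2·√c₁·c₃)`. -/
noncomputable def D (c₁ r c₃ : ℝ) : ℝ :=
  (-Real.sqrt c₁ + 2 * Real.sqrt c₃ * Real.cosh ((Real.sqrt c₃ - Real.sqrt c₁) * r)) /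
    (2 * Real.sqrt c₁ * c₃)

theorem hasDerivAt_D {c x : ℝ} (hc : 0 < c) (r : ℝ) (hx : 0 < x) :
    HasDerivAt (D c r)
      ((Real.sqrt c - Real.sqrt x * Real.cosh ((Real.sqrt x - Real.sqrt c) * r)
        + x * r * Real.sinh ((Real.sqrt x - Real.sqrt c) * r)) / (2 * Real.sqrt c * x ^ 2)) x := by
  have hs : HasDerivAt Real.sqrt (1 / (2 * Real.sqrt x)) x := Real.hasDerivAt_sqrt hx.ne'
  have hcosh := ((hs.sub_const (Real.sqrt c)).mul_const r).cosh
  have hnum := ((hs.const_mul 2).mul hcosh).const_add (-Real.sqrt c)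
  have hden := (hasDerivAt_id x).const_mul (2 * Real.sqrt c)
  have hsc : 0 < Real.sqrt c := Real.sqrt_pos.2 hc
  have hsx : 0 < Real.sqrt x := Real.sqrt_pos.2 hx
  have hden0 : 2 * Real.sqrt c * id x ≠ 0 := by
    simp only [id]
    positivity
  refine (hnum.div hden hden0).congr_deriv ?_
  have hxx : x = Real.sqrt x ^ 2 := (Real.sq_sqrt hx.le).symm
  simp only [id, Pi.mul_apply]
  generalize Real.sinh ((Real.sqrt x - Real.sqrt c) * r) = S
  generalize Real.cosh ((Real.sqrt x - Real.sqrt c) * r) = C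
  generalize Real.sqrt x = s at *
  subst hxx
  field_simp
  ring

theorem Real.lt_cosh_of_log_two_mul_le {t y : ℝ} (hy : 0 < y) (h : Real.log (2 * y) ≤ t) :
    y < Real.cosh t := by
  have hexp : 2 * y ≤ Real.exp t := (Real.log_le_iff_le_exp (by positivity)).1 h
  rw [Real.cosh_eq]
  linarith [Real.exp_pos (-t)]

theorem stmt_17 (c₁ c₂ r M : ℝ) (hc₁ : 0 < c₁) (hc : c₁ < c₂)
    (hM : M = Real.sqrt c₂ - Real.sqrt c₁) (hr : 0 < r)
    (hMr : M * r ≥ Real.log (2 * Real.sqrt c₂ / Real.sqrt c₁)) :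
    Real.sqrt c₂ - Real.sqrt c₁ * Real.cosh (M * r) - c₁ * r * Real.sinh (M * r) < 0 ∧
      deriv (fun c₃ => D c₁ r c₃ + D c₂ r c₃) c₁ < 0 := by
  have hc₂ : 0 < c₂ := hc₁.trans hc
  have ha : 0 < Real.sqrt c₁ := Real.sqrt_pos.2 hc₁
  have hb : 0 < Real.sqrt c₂ := Real.sqrt_pos.2 hc₂
  have hM0 : 0 < M := by
    rw [hM]
    exact sub_pos.2 (Real.sqrt_lt_sqrt hc₁.le hc)
  have hcosh : Real.sqrt c₂ < Real.sqrt c₁ * Real.cosh (M * r) := by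
    rw [mul_div_assoc] at hMr
    exact (div_lt_iff₀' ha).1 (Real.lt_cosh_of_log_two_mul_le (by positivity) hMr)
  have hsinh : 0 < c₁ * r * Real.sinh (M * r) :=
    mul_pos (mul_pos hc₁ hr) (Real.sinh_pos_iff.2 (mul_pos hM0 hr))
  have hneg : Real.sqrt c₂ - Real.sqrt c₁ * Real.cosh (M * r) - c₁ * r * Real.sinh (M * r) < 0 := by
    linarith
  refine ⟨hneg, ?_⟩
  rw [((hasDerivAt_D hc₁ r hc₁).fun_add (hasDerivAt_D hc₂ r hc₁)).deriv]
  have harg : (Real.sqrt c₁ - Real.sqrt c₂) * r = -(M * r) := by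
    rw [hM]
    ring
  rw [harg, Real.cosh_neg, Real.sinh_neg]
  simp only [sub_self, zero_mul, Real.cosh_zero, Real.sinh_zero, mul_one, mul_zero, add_zero,
    zero_div, zero_add]
  exact div_neg_of_neg_of_pos (by linarith) (by positivity)
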